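/- Let χ be a linear functional on W of height -1 or 0 (so that 0 and p-1 lie in Λ(χ) = F_p), and let (λ, λ') = (0, p-1) or (λ, λ') = (p-1, 0). Then Ext(K_{λ'}, V_χ(λ)), taken in the category of W_0-modules with p-character χ (with V_χ(λ) regarded as a W_0-module by restriction), is isomorphic to K. -/

import Mathlib

/-!
Common setup: the Witt algebra `W` over `K` (char `p > 3`) has basis
`e_{-1}, e_0, ..., e_{p-2}` with `[e_i, e_j] = (j-i) e_{i+j}` (and `e_k = 0`
outside the range), and `p`-mapping `e_i^{[p]} = δ_{i0} e_i`.  A module with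
`p`-character `χ` over `W` (resp. the subalgebra `W_0 = <e_0, ..., e_{p-2}>`)
is given by a family of endomorphisms `ρ k` (`k : ℤ`, vanishing outside
`[lo, p-2]` where `lo = -1` for `W` and `lo = 0` for `W_0`) satisfying the
bracket relations and `(ρ i)^p - δ_{i0} ρ i = χ(e_i)^p • 1`.

The Baer Ext space `Ext(N, M)` of two such modules, in the category of
modules with `p`-character `χ`, is realized concretely: an extension
`0 → M → E → N → 0` admits a linear splitting `E ≃ M ⊕ N`, under which the
action of `e_k` is `(m, n) ↦ (ρM k m + c k n, ρN k n)` for a "cocycle"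
`c : ℤ → (N →ₗ M)`; the conditions for `E` to be a module with `p`-character
`χ` are the cocycle conditions below, Baer equivalence corresponds to
differing by a coboundary, and the Baer sum / scalar action correspond to the
linear structure on cocycles.  So `Ext(N, M) ≅ cocycles / coboundaries`.
-/

set_option maxHeartbeats 1000000
set_option synthInstance.maxHeartbeats 1000000

noncomputable section

/-- The coefficient `(-1)^j · (i!/(i-j)!) · ((j+1)λ - i + j)` of the action
`e_j · v_i = (coefficient) · v_{i-j}` on the reduced Verma module; it vanishes
for `j > i` since then `Nat.descFactorial i j = 0`. -/
def wCoef (K : Type) [Field K] (lam : K) (j i : ℕ) : K :=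
  (-1 : K) ^ j * (Nat.descFactorial i j : K) * (((j : K) + 1) * lam - (i : K) + (j : K))

/-- Matrices (in the basis `v_0, ..., v_{p-1}`) of the generators `e_j`
(`j : ℤ`) acting on the reduced Verma module `V_χ(λ)`; here `c = χ(e_{-1})^p`.
`e_{-1} v_i = v_{i+1}` for `i < p-1`, `e_{-1} v_{p-1} = c v_0`, and for
`0 ≤ j ≤ p-2`, `e_j v_i = (-1)^j (i!/(i-j)!) ((j+1)λ - i + j) v_{i-j}`. -/
def vermaMat (K : Type) [Field K] (p : ℕ) (c lam : K) : ℤ → Matrix (Fin p) (Fin p) K :=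
  fun j =>
    if j = -1 then
      Matrix.of fun k l =>
        if (k : ℕ) = (l : ℕ) + 1 then 1
        else if (k : ℕ) = 0 ∧ (l : ℕ) = p - 1 then c else 0
    else if 0 ≤ j ∧ j ≤ (p : ℤ) - 2 then
      Matrix.of fun k l =>
        if (l : ℕ) = (k : ℕ) + j.toNat then wCoef K lam j.toNat (l : ℕ) else 0
    else 0

/-- The action of the basis elements `e_j` (`j : ℤ`) on the reduced Verma
module `V_χ(λ)`, with `c = χ(e_{-1})^p`. -/
def vermaRho (K : Type) [Field K] (p : ℕ) (c lam : K) : ℤ → Module.End K (Fin p → K) :=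
  fun j => Matrix.toLin' (vermaMat K p c lam j)

/-- The one-dimensional `W_0`-module `K_λ`: `e_0` acts by `λ`, all other `e_j` act by `0`. -/
def oneDimRho (K : Type) [Field K] (lam : K) : ℤ → Module.End K K :=
  fun j => if j = 0 then lam • (1 : Module.End K K) else 0

/-- The one-dimensional trivial module: every basis element acts by `0`. -/
def trivRho (K : Type) [Field K] : ℤ → Module.End K K := fun _ => 0

/-- The coefficient `(-1)^(j+1) · ((i+1)!/(i-j)!)` of the action
`e_j · u_i = (coefficient) · u_{i-j}` on the `(p-1)`-dimensional simple module `S`. -/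
def sCoef (K : Type) [Field K] (j i : ℕ) : K :=
  (-1 : K) ^ (j + 1) * (Nat.descFactorial (i + 1) (j + 1) : K)

/-- Matrices (in the basis `u_0, ..., u_{p-2}`) of the generators `e_j` acting on
the `(p-1)`-dimensional simple restricted module `S = V_0(p-1)/Soc(V_0(p-1))`. -/
def sMat (K : Type) [Field K] (p : ℕ) : ℤ → Matrix (Fin (p - 1)) (Fin (p - 1)) K :=
  fun j =>
    if j = -1 then
      Matrix.of fun k l => if (k : ℕ) = (l : ℕ) + 1 then 1 else 0
    else if 0 ≤ j ∧ j ≤ (p : ℤ) - 2 then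
      Matrix.of fun k l =>
        if (l : ℕ) = (k : ℕ) + j.toNat then sCoef K j.toNat (l : ℕ) else 0
    else 0

/-- The action of the basis elements `e_j` on the simple module `S`. -/
def sRho (K : Type) [Field K] (p : ℕ) : ℤ → Module.End K (Fin (p - 1) → K) :=
  fun j => Matrix.toLin' (sMat K p j)

section ExtSpace

variable (K : Type) [Field K] (M N : Type) [AddCommGroup M] [Module K M]
  [AddCommGroup N] [Module K N]

/-- Constraint: a cocycle vanishes outside the index range `[lo, p-2]`. -/
def suppConstraint (p : ℕ) (lo k : ℤ) : (ℤ → N →ₗ[K] M) →ₗ[K] (N →ₗ[K] M) :=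
  if k < lo ∨ (p : ℤ) - 2 < k then LinearMap.proj k else 0

variable {M N}

/-- Constraint on a cocycle coming from the bracket relation
`[e_i, e_j] = (j - i) e_{i+j}`:
`(j-i) c(i+j) = ρM i ∘ c j + c i ∘ ρN j - ρM j ∘ c i - c j ∘ ρN i`. -/
def bracketConstraint (p : ℕ) (lo : ℤ) (ρM : ℤ → Module.End K M)
    (ρN : ℤ → Module.End K N) (i j : ℤ) :
    (ℤ → N →ₗ[K] M) →ₗ[K] (N →ₗ[K] M) :=
  if lo ≤ i ∧ i ≤ (p : ℤ) - 2 ∧ lo ≤ j ∧ j ≤ (p : ℤ) - 2 then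
    ((j - i : ℤ) : K) • LinearMap.proj (i + j)
      - LinearMap.llcomp K N M M (ρM i) ∘ₗ LinearMap.proj j
      - LinearMap.lcomp K M (ρN j) ∘ₗ LinearMap.proj i
      + LinearMap.llcomp K N M M (ρM j) ∘ₗ LinearMap.proj i
      + LinearMap.lcomp K M (ρN i) ∘ₗ LinearMap.proj j
  else 0

/-- Constraint on a cocycle expressing that the extension has `p`-character `χ`:
on the extension `E = M ⊕ N` the `(N → M)`-component of `(e_i)^p` is
`∑_{k<p} (ρM i)^k ∘ c i ∘ (ρN i)^(p-1-k)`, and this must agree with the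
`(N → M)`-component of `e_i^{[p]} + χ(e_i)^p • 1`, which is `δ_{i0} c i`
(the scalar `χ(e_i)^p` contributes nothing off the diagonal, and the diagonal
blocks hold since `M`, `N` have `p`-character `χ`). -/
def pcharConstraint (p : ℕ) (lo : ℤ) (ρM : ℤ → Module.End K M)
    (ρN : ℤ → Module.End K N) (i : ℤ) :
    (ℤ → N →ₗ[K] M) →ₗ[K] (N →ₗ[K] M) :=
  if lo ≤ i ∧ i ≤ (p : ℤ) - 2 then
    (∑ k ∈ Finset.range p,
        LinearMap.llcomp K N M M ((ρM i) ^ k) ∘ₗ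
          LinearMap.lcomp K M ((ρN i) ^ (p - 1 - k)) ∘ₗ LinearMap.proj i)
      - (if i = 0 then (LinearMap.proj 0 : (ℤ → N →ₗ[K] M) →ₗ[K] (N →ₗ[K] M)) else 0)
  else 0

/-- The space of cocycles: families `c : ℤ → (N →ₗ M)` (the values of a linear
map `W → Hom(N, M)` on the basis, `lo = -1` for `W` and `lo = 0` for `W_0`)
such that `M ⊕ N` with action `e_k (m, n) = (ρM k m + c k n, ρN k n)` is a
module with `p`-character `χ`. -/
def cocycles (p : ℕ) (lo : ℤ) (ρM : ℤ → Module.End K M) (ρN : ℤ → Module.End K N) :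
    Submodule K (ℤ → N →ₗ[K] M) :=
  (⨅ k : ℤ, LinearMap.ker (suppConstraint K M N p lo k)) ⊓
    (⨅ i : ℤ, ⨅ j : ℤ, LinearMap.ker (bracketConstraint K p lo ρM ρN i j)) ⊓
    (⨅ i : ℤ, LinearMap.ker (pcharConstraint K p lo ρM ρN i))

/-- The coboundaries: cocycles of the form `k ↦ ρM k ∘ f - f ∘ ρN k` for a
linear map `f : N → M`; these are exactly the cocycles of split extensions,
and two cocycles give Baer-equivalent extensions iff they differ by a
coboundary. -/
def coboundaries (p : ℕ) (lo : ℤ) (ρM : ℤ → Module.End K M) (ρN : ℤ → Module.End K N) :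
    Submodule K (ℤ → N →ₗ[K] M) :=
  LinearMap.range (LinearMap.pi fun k : ℤ =>
    if lo ≤ k ∧ k ≤ (p : ℤ) - 2 then
      LinearMap.llcomp K N M M (ρM k) - LinearMap.lcomp K M (ρN k)
    else 0)

/-- The Baer Ext space `Ext(N, M)` in the category of modules with
`p`-character `χ` (over `W` if `lo = -1`, over `W_0` if `lo = 0`), realized
as cocycles modulo coboundaries. -/
abbrev extSpace (p : ℕ) (lo : ℤ) (ρM : ℤ → Module.End K M) (ρN : ℤ → Module.End K N) :=
  (cocycles K p lo ρM ρN) ⧸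
    (Submodule.comap (cocycles K p lo ρM ρN).subtype (coboundaries K p lo ρM ρN))

end ExtSpace

end

section Auxiliary

variable {K : Type} [Field K] {p : ℕ}

/-- The `m`-th coordinate of a vector, extended by zero to all natural numbers `m`. -/
def coordAt (v : Fin p → K) (m : ℕ) : K := if h : m < p then v ⟨m, h⟩ else 0

lemma coordAt_val (v : Fin p → K) (m : Fin p) : coordAt v m = v m := by
  simp [coordAt]

lemma coordAt_of_le (v : Fin p → K) {m : ℕ} (hm : p ≤ m) : coordAt v m = 0 := by
  simp [coordAt, hm]

lemma coordAt_zero (m : ℕ) : coordAt (0 : Fin p → K) m = 0 := by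
  simp [coordAt]

lemma vermaRho_apply (c lam : K) {j : ℕ} (hj : j + 2 ≤ p) (v : Fin p → K) (m : Fin p) :
    vermaRho K p c lam j v m = wCoef K lam j (m + j) * coordAt v (m + j) := by
  have h1 : ¬ ((j : ℤ) = -1) := by omega
  have h2 : (0 : ℤ) ≤ j ∧ (j : ℤ) ≤ (p : ℤ) - 2 := by omega
  simp only [vermaRho, vermaMat, if_neg h1, if_pos h2, Matrix.toLin'_apply, Matrix.mulVec,
    dotProduct, Matrix.of_apply, Int.toNat_natCast]
  unfold coordAt
  split_ifs with h
  · rw [Finset.sum_eq_single (⟨m + j, h⟩ : Fin p)]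
    · simp
    · intro b _ hb
      rw [if_neg, zero_mul]
      exact fun h' => hb (Fin.ext h')
    · simp
  · rw [mul_zero]
    refine Finset.sum_eq_zero fun b _ => ?_
    rw [if_neg, zero_mul]
    have := b.2
    omega

lemma wCoef_zero_left (lam : K) (i : ℕ) : wCoef K lam 0 i = lam - i := by
  simp [wCoef]

lemma vermaRho_zero_pow_apply (hp : 2 ≤ p) (c lam : K) (n : ℕ) (v : Fin p → K) (m : Fin p) :
    ((vermaRho K p c lam 0) ^ n) v m = (lam - (m : ℕ)) ^ n * v m := by
  induction n generalizing v with
  | zero => simp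
  | succ n ih =>
    have := vermaRho_apply c lam (j := 0) (by omega) v m
    rw [pow_succ, Module.End.mul_apply, ih]
    simp only [Nat.cast_zero, add_zero, wCoef_zero_left, coordAt_val] at this
    rw [this]
    ring

lemma oneDimRho_apply (mu : K) (k : ℤ) (a : K) :
    oneDimRho K mu k a = if k = 0 then mu * a else 0 := by
  unfold oneDimRho
  split_ifs <;> simp

lemma oneDimRho_pow_one (mu : K) (k : ℤ) (n : ℕ) :
    ((oneDimRho K mu k) ^ n) 1 = (if k = 0 then mu else 0) ^ n := by
  induction n with
  | zero => simp
  | succ n ih =>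
    rw [pow_succ', Module.End.mul_apply, ih, oneDimRho_apply]
    split_ifs <;> simp [pow_succ']

lemma map_eq_smul_one {M : Type} [AddCommGroup M] [Module K M] (g : K →ₗ[K] M) (a : K) :
    g a = a • g 1 := by
  rw [← map_smul, smul_eq_mul, mul_one]

/-- A family of linear maps out of a one-dimensional module is a cocycle iff the images of `1`
satisfy the expected equations. -/
lemma mem_cocycles_oneDim_iff {M : Type} [AddCommGroup M] [Module K M]
    (ρ : ℤ → Module.End K M) (mu : K) (w : ℤ → K →ₗ[K] M) :
    w ∈ cocycles K p 0 ρ (oneDimRho K mu) ↔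
      (∀ k : ℤ, k < 0 ∨ (p : ℤ) - 2 < k → w k 1 = 0) ∧
      (∀ i j : ℕ, i + 2 ≤ p → j + 2 ≤ p →
        ((j : K) - i) • w ((i + j : ℕ) : ℤ) 1 =
          ρ i (w j 1) - ρ j (w i 1) + (if j = 0 then mu else 0) • w i 1
            - (if i = 0 then mu else 0) • w j 1) ∧
      (∀ i : ℕ, i + 2 ≤ p →
        ∑ k ∈ Finset.range p,
            ((if i = 0 then mu else 0) ^ (p - 1 - k) : K) • ((ρ i) ^ k) (w i 1) =
          if i = 0 then w 0 1 else 0) := by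
  simp only [cocycles, Submodule.mem_inf, Submodule.mem_iInf, LinearMap.mem_ker, and_assoc]
  refine and_congr (forall_congr' fun k => ?_) (and_congr ⟨fun h i j hi hj => ?_, fun h i j => ?_⟩
    ⟨fun h i hi => ?_, fun h i => ?_⟩)
  · unfold suppConstraint
    split_ifs with hk
    · simp only [LinearMap.proj_apply, hk, forall_true_left]
      exact ⟨fun h => by rw [h]; rfl, fun h => LinearMap.ext_ring (by simpa using h)⟩
    · simp [hk]
  · have h1 := h i j
    rw [bracketConstraint, if_pos (by omega)] at h1
    have h2 := LinearMap.congr_fun h1 1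
    simp only [Int.cast_sub, Int.cast_natCast, LinearMap.add_apply, LinearMap.sub_apply,
      LinearMap.smul_apply, LinearMap.coe_comp, Function.comp_apply, LinearMap.llcomp_apply,
      LinearMap.lcomp_apply, LinearMap.proj_apply, oneDimRho_apply, Nat.cast_eq_zero, mul_one,
      LinearMap.zero_apply, map_eq_smul_one (w _) (ite _ _ _)] at h2
    rw [← sub_eq_zero, ← h2, Nat.cast_add]
    abel
  · unfold bracketConstraint
    split_ifs with hij
    · obtain ⟨i, rfl⟩ := Int.eq_ofNat_of_zero_le hij.1
      obtain ⟨j, rfl⟩ := Int.eq_ofNat_of_zero_le hij.2.2.1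
      have := h i j (by omega) (by omega)
      apply LinearMap.ext_ring
      simp only [Int.cast_sub, Int.cast_natCast, LinearMap.add_apply, LinearMap.sub_apply,
        LinearMap.smul_apply, LinearMap.coe_comp, Function.comp_apply, LinearMap.llcomp_apply,
        LinearMap.lcomp_apply, LinearMap.proj_apply, oneDimRho_apply, Nat.cast_eq_zero, mul_one,
        LinearMap.zero_apply, map_eq_smul_one (w _) (ite _ _ _)]
      rw [← Nat.cast_add, this]
      abel
    · simp
  · have h1 := h i
    rw [pcharConstraint, if_pos (by omega)] at h1
    have h2 := LinearMap.congr_fun h1 1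
    simp only [Nat.cast_eq_zero, LinearMap.sub_apply, LinearMap.sum_apply, LinearMap.coe_comp,
      Function.comp_apply, LinearMap.llcomp_apply, LinearMap.lcomp_apply, LinearMap.proj_apply,
      oneDimRho_pow_one, LinearMap.zero_apply, map_eq_smul_one (w _) (_ ^ _), map_smul,
      sub_eq_zero] at h2
    rw [h2]
    split_ifs <;> simp
  · unfold pcharConstraint
    split_ifs with hi hi0
    · subst hi0
      have := h 0 (by omega)
      apply LinearMap.ext_ring
      simpa [oneDimRho_pow_one, map_eq_smul_one (w _) (_ ^ _), sub_eq_zero] using this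
    · obtain ⟨i, rfl⟩ := Int.eq_ofNat_of_zero_le hi.1
      have := h i (by omega)
      apply LinearMap.ext_ring
      simp only [Nat.cast_eq_zero] at hi0
      simpa [oneDimRho_pow_one, map_eq_smul_one (w _) (_ ^ _), hi0] using this
    · simp

lemma mem_coboundaries_oneDim_iff {M : Type} [AddCommGroup M] [Module K M]
    (ρ : ℤ → Module.End K M) (mu : K) (w : ℤ → K →ₗ[K] M) :
    w ∈ coboundaries K p 0 ρ (oneDimRho K mu) ↔
      ∃ f : M, ∀ k : ℤ, w k 1 =
        if 0 ≤ k ∧ k ≤ (p : ℤ) - 2 then ρ k f - (if k = 0 then mu else 0) • f else 0 := by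
  rw [coboundaries, LinearMap.mem_range]
  constructor
  · rintro ⟨f, rfl⟩
    refine ⟨f 1, fun k => ?_⟩
    rw [LinearMap.pi_apply]
    by_cases hk0 : k = 0 <;> split_ifs <;> simp [oneDimRho_apply, hk0, map_eq_smul_one f mu]
  · rintro ⟨f, hf⟩
    refine ⟨LinearMap.toSpanSingleton K M f, funext fun k => LinearMap.ext_ring ?_⟩
    rw [hf, LinearMap.pi_apply]
    by_cases hk0 : k = 0 <;> split_ifs <;> simp [oneDimRho_apply, hk0]

lemma exists_vermaRho_pow_apply (c lam : K) {j : ℕ} (hj : j + 2 ≤ p) (n : ℕ) (v : Fin p → K)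
    (m : Fin p) :
    ∃ a : K, ((vermaRho K p c lam j) ^ n) v m = a * coordAt v (m + n * j) := by
  induction n generalizing m with
  | zero => exact ⟨1, by simp [coordAt_val]⟩
  | succ n ih =>
    rw [pow_succ', Module.End.mul_apply, vermaRho_apply c lam hj]
    by_cases hm : m + j < p
    · obtain ⟨a, ha⟩ := ih ⟨m + j, hm⟩
      refine ⟨wCoef K lam j (m + j) * a, ?_⟩
      rw [coordAt, dif_pos hm, ha, mul_assoc, add_mul, one_mul]
      congr 3
      ring
    · refine ⟨0, ?_⟩
      rw [coordAt_of_le _ (by omega), mul_zero, zero_mul]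

/-- The part of the cocycle condition involving only `e_1, ..., e_{p-2}`, for cochains with values
in a reduced Verma module. -/
def PosCocycle (lam : K) (x : ℕ → Fin p → K) : Prop :=
  (∀ j, p ≤ j + 1 → x j = 0) ∧
  ∀ i j : ℕ, 1 ≤ i → 1 ≤ j → i + 2 ≤ p → j + 2 ≤ p → ∀ m : Fin p,
    ((j : K) - i) * x (i + j) m =
      wCoef K lam i (m + i) * coordAt (x j) (m + i) - wCoef K lam j (m + j) * coordAt (x i) (m + j)

/-- The cochain on `W_0` whose value at `e_k` sends `1` to `x k`. -/
def toCochain (x : ℕ → Fin p → K) : ℤ → K →ₗ[K] (Fin p → K) :=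
  fun k => if 0 ≤ k then LinearMap.toSpanSingleton K _ (x k.toNat) else 0

lemma toCochain_natCast (x : ℕ → Fin p → K) (j : ℕ) : toCochain x j 1 = x j := by
  simp [toCochain]

lemma toCochain_mem_cocycles [CharP K p] (hp : 2 ≤ p) (c : K) {lam mu : K} (hne : lam ≠ mu)
    {z : ℕ → Fin p → K} (hz : PosCocycle lam z) (hz0 : z 0 = 0)
    (hwt : ∀ (j : ℕ) (m : Fin p), lam - (m : ℕ) - mu ≠ j → z j m = 0) :
    toCochain z ∈ cocycles K p 0 (vermaRho K p c lam) (oneDimRho K mu) := by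
  have hwt' : ∀ (j : ℕ) (m : Fin p), (lam - (m : ℕ) - mu - j) * z j m = 0 := fun j m => by
    by_cases h : lam - (m : ℕ) - mu = j
    · rw [h, sub_self, zero_mul]
    · rw [hwt j m h, mul_zero]
  have h00 : toCochain z 0 1 = 0 := by simp [toCochain, hz0]
  rw [mem_cocycles_oneDim_iff]
  refine ⟨fun k hk => ?_, fun i j hi hj => ?_, fun i hi => ?_⟩
  · unfold toCochain
    split_ifs with h
    · simp [hz.1 k.toNat (by omega)]
    · simp
  · simp only [toCochain_natCast]
    ext m
    simp only [Pi.add_apply, Pi.sub_apply, Pi.smul_apply, smul_eq_mul, vermaRho_apply c lam hi,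
      vermaRho_apply c lam hj]
    rcases Nat.eq_zero_or_pos i with rfl | hi0
    · rcases Nat.eq_zero_or_pos j with rfl | hj0
      · simp [hz0]
      · have := hwt' j m
        simp only [hz0, wCoef_zero_left, coordAt_zero, coordAt_val, add_zero, zero_add,
          Pi.zero_apply, mul_zero, if_true, Nat.cast_zero]
        linear_combination -this
    · rcases Nat.eq_zero_or_pos j with rfl | hj0
      · have := hwt' i m
        simp only [hz0, wCoef_zero_left, coordAt_zero, coordAt_val, add_zero,
          Pi.zero_apply, mul_zero, if_true, Nat.cast_zero]
        linear_combination this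
      · rw [hz.2 i j hi0 hj0 hi hj m, if_neg hi0.ne', if_neg hj0.ne']
        ring
  · rcases Nat.eq_zero_or_pos i with rfl | hi0
    · simp [h00]
    · rw [if_neg hi0.ne', if_neg hi0.ne', toCochain_natCast,
        Finset.sum_eq_single_of_mem (p - 1) (by simp; omega)]
      · ext m
        obtain ⟨a, ha⟩ := exists_vermaRho_pow_apply c lam hi (p - 1) (z i) m
        rw [Pi.smul_apply, ha, Pi.zero_apply]
        suffices coordAt (z i) (m + (p - 1) * i) = 0 by simp [this]
        unfold coordAt
        split_ifs with h
        · have hi1 : i = 1 := by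
            by_contra hi1
            have : (p - 1) * 2 ≤ (p - 1) * i := Nat.mul_le_mul_left _ (by omega)
            omega
          subst hi1
          apply hwt
          have : (m : ℕ) + (p - 1) * 1 = p - 1 := by omega
          simp only [this, Nat.cast_sub (show 1 ≤ p by omega), CharP.cast_eq_zero, Nat.cast_one]
          intro h'
          exact hne (by linear_combination h')
        · rfl
      · intro k hk hk'
        rw [Finset.mem_range] at hk
        rw [zero_pow (by omega), zero_smul]

lemma toCochain_notMem_coboundaries (c : K) {lam mu : K} {z : ℕ → Fin p → K} {j : ℕ} (hj : 1 ≤ j)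
    (hjp : j + 2 ≤ p) {m : Fin p} (hzm : z j m ≠ 0) (hcoef : wCoef K lam j (m + j) = 0) :
    toCochain z ∉ coboundaries K p 0 (vermaRho K p c lam) (oneDimRho K mu) := by
  rw [mem_coboundaries_oneDim_iff]
  rintro ⟨f, hf⟩
  have h := congrFun (hf j) m
  rw [toCochain_natCast, if_pos (by omega), if_neg (by omega), zero_smul, sub_zero,
    vermaRho_apply c lam hjp, hcoef, zero_mul] at h
  exact hzm h

/-- If the weight-zero part of the positive cocycles is spanned by a single class `z` which is not
a coboundary, then the Ext space is one-dimensional. -/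
lemma finrank_extSpace_eq_one [CharP K p] (hp : 2 ≤ p) (c : K) {lam mu : K}
    (z : ℕ → Fin p → K)
    (hz : toCochain z ∈ cocycles K p 0 (vermaRho K p c lam) (oneDimRho K mu))
    (hz' : toCochain z ∉ coboundaries K p 0 (vermaRho K p c lam) (oneDimRho K mu))
    (hz0 : z 0 = 0)
    (hwt : ∀ (j : ℕ) (m : Fin p), lam - (m : ℕ) - mu ≠ j → z j m = 0)
    (huniq : ∀ x : ℕ → Fin p → K, PosCocycle lam x → ∃ t : K, ∀ j : ℕ, 1 ≤ j → j + 2 ≤ p →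
      ∀ m : Fin p, lam - (m : ℕ) - mu = j → x j m = t * z j m) :
    Module.finrank K (extSpace K p 0 (vermaRho K p c lam) (oneDimRho K mu)) = 1 := by
  refine finrank_eq_one (Submodule.Quotient.mk ⟨toCochain z, hz⟩) ?_ ?_
  · rwa [Ne, Submodule.Quotient.mk_eq_zero, Submodule.mem_comap]
  intro w
  obtain ⟨⟨w, hw⟩, rfl⟩ := Submodule.Quotient.mk_surjective _ w
  have hwc := (mem_cocycles_oneDim_iff _ _ _).1 hw
  obtain ⟨hsupp, hbr, hpc⟩ := hwc
  obtain ⟨t, ht⟩ := huniq (fun j => w j 1) ⟨fun j hj => hsupp j (by omega),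
    fun i j hi hj hip hjp m => by
      have := congrFun (hbr i j hip hjp) m
      simpa [vermaRho_apply c lam hip, vermaRho_apply c lam hjp, Nat.one_le_iff_ne_zero.1 hi,
        Nat.one_le_iff_ne_zero.1 hj] using this⟩
  refine ⟨t, ?_⟩
  rw [← Submodule.Quotient.mk_smul, eq_comm, Submodule.Quotient.eq, Submodule.mem_comap]
  change w - t • toCochain z ∈ _
  rw [mem_coboundaries_oneDim_iff]
  have hw0 : ∀ m : Fin p, lam - (m : ℕ) - mu = 0 → w 0 1 m = 0 := fun m hm => by
    have h := congrFun (hpc 0 (by omega)) m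
    simp only [if_true, Nat.cast_zero, Finset.sum_apply, Pi.smul_apply, smul_eq_mul,
      vermaRho_zero_pow_apply hp] at h
    rw [← h, sub_eq_zero.1 hm]
    have : ∀ k ∈ Finset.range p, mu ^ (p - 1 - k) * (mu ^ k * w 0 1 m) =
        mu ^ (p - 1) * w 0 1 m := fun k hk => by
      rw [Finset.mem_range] at hk
      rw [← mul_assoc, ← pow_add, Nat.sub_add_cancel (by omega)]
    rw [Finset.sum_congr rfl this]
    simp
  refine ⟨fun m => w 0 1 m / (lam - (m : ℕ) - mu), fun k => ?_⟩
  split_ifs with hk hk0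
  · subst hk0
    ext m
    have := vermaRho_apply c lam (j := 0) hp (fun m : Fin p => w 0 1 m / (lam - (m : ℕ) - mu)) m
    rw [add_zero, wCoef_zero_left, coordAt_val, Nat.cast_zero] at this
    have hz00 : toCochain z 0 1 = 0 := by simp [toCochain, hz0]
    simp only [Pi.sub_apply, Pi.smul_apply, LinearMap.sub_apply, LinearMap.smul_apply, this, hz00,
      smul_eq_mul, smul_zero, Pi.zero_apply, sub_zero]
    by_cases hm : lam - (m : ℕ) - mu = 0
    · simp [hm, hw0 m hm]
    · field_simp
  · obtain ⟨j, rfl⟩ := Int.eq_ofNat_of_zero_le hk.1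
    have hj : 1 ≤ j := by omega
    have hjp : j + 2 ≤ p := by omega
    ext m
    simp only [Pi.sub_apply, Pi.smul_apply, LinearMap.sub_apply, LinearMap.smul_apply,
      toCochain_natCast, vermaRho_apply c lam hjp, smul_eq_mul, zero_smul, Pi.zero_apply, sub_zero]
    have h := congrFun (hbr 0 j hp hjp) m
    have h0 := vermaRho_apply c lam (j := 0) hp (w j 1) m
    rw [add_zero, wCoef_zero_left, coordAt_val, Nat.cast_zero] at h0
    simp only [Pi.add_apply, Pi.sub_apply, Pi.smul_apply, smul_eq_mul, h0,
      vermaRho_apply c lam hjp, Nat.one_le_iff_ne_zero.1 hj, if_true, if_false, zero_mul,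
      Nat.cast_zero, zero_add, add_zero, sub_zero] at h
    by_cases hm : lam - (m : ℕ) - mu = j
    · rw [ht j hj hjp m hm, sub_self]
      unfold coordAt
      split_ifs with hmj
      · have : lam - ((m + j : ℕ) : K) - mu = 0 := by push_cast; linear_combination hm
        dsimp only
        rw [this, div_zero, mul_zero]
      · simp
    · rw [hwt j m hm, mul_zero, sub_zero]
      have hm' : lam - (m : ℕ) - mu - j ≠ 0 := sub_ne_zero.2 hm
      have h' : (lam - (m : ℕ) - mu - j) * w j 1 m =
          wCoef K lam j (m + j) * coordAt (w 0 1) (m + j) := by linear_combination -h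
      rw [eq_div_of_mul_eq hm' ((mul_comm _ _).trans h'), mul_div_assoc]
      congr 1
      unfold coordAt
      split_ifs
      · push_cast
        congr 1
        ring
      · simp
  · have h1 := hsupp k (by omega)
    have h2 := ((mem_cocycles_oneDim_iff _ _ _).1 hz).1 k (by omega)
    simp [h1, h2]

lemma natCast_ne_zero_of_lt [CharP K p] {n : ℕ} (h0 : 0 < n) (hn : n < p) : (n : K) ≠ 0 :=
  fun h => Nat.not_dvd_of_pos_of_lt h0 hn ((CharP.cast_eq_zero_iff K p n).1 h)

lemma factorial_mul_wCoef_neg_one [CharP K p] {n j : ℕ} (h : n + j + 1 = p) (i : ℕ) :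
    (j.factorial : K) * wCoef K (-1) i n = (i + j).factorial * j := by
  have hcast : (n : K) + j + 1 = 0 := by exact_mod_cast h ▸ CharP.cast_eq_zero K p
  have hdesc : ∀ i : ℕ, (j.factorial : K) * n.descFactorial i = (-1) ^ i * (i + j).factorial := by
    intro i
    induction i with
    | zero => simp
    | succ i ih =>
      have hi : (((n - i : ℕ) : K)) * n.descFactorial i = (n - i) * n.descFactorial i := by
        rcases le_or_gt i n with hin | hin
        · rw [Nat.cast_sub hin]
        · simp [Nat.descFactorial_eq_zero_iff_lt.2 hin]
      rw [Nat.descFactorial_succ, Nat.cast_mul, hi, Nat.add_right_comm, Nat.factorial_succ]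
      push_cast
      linear_combination ((n : K) - i) * ih + (-1) ^ i * ((i + j).factorial : K) * hcast
  have h1 : ((-1 : K) ^ i) * (-1) ^ i = 1 := by rw [← mul_pow]; simp
  unfold wCoef
  linear_combination (-1) ^ i * (((i : K) + 1) * -1 - n + i) * hdesc i +
    (i + j).factorial * ((((i : K) + 1) * -1 - n + i) * h1 - hcast)

lemma wCoef_one_left (lam : K) {n : ℕ} :
    wCoef K lam 1 n = -(n * (2 * lam - n + 1)) := by
  simp only [wCoef, Nat.descFactorial_one, Nat.cast_one]
  ring

lemma finrank_extSpace_zero_neg_one [CharP K p] (hp : 3 < p) (c : K) :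
    Module.finrank K (extSpace K p 0 (vermaRho K p c 0) (oneDimRho K (-1))) = 1 := by
  let z : ℕ → Fin p → K := fun j m => if j = 1 ∧ (m : ℕ) = 0 then 1 else 0
  have hz0 : z 0 = 0 := by ext m; simp [z]
  have hzj : ∀ j ≠ 1, z j = 0 := fun j hj => by ext m; simp [z, hj]
  have hwt : ∀ (j : ℕ) (m : Fin p), (0 : K) - (m : ℕ) - -1 ≠ j → z j m = 0 := by
    intro j m h
    refine if_neg ?_
    rintro ⟨rfl, h0⟩
    simp [h0] at h
  have hz : PosCocycle (0 : K) z := by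
    refine ⟨fun j hj => hzj j (by omega), fun i j hi hj hip hjp m => ?_⟩
    have h1 : ∀ k l : ℕ, 1 ≤ k → coordAt (z l) (m + k) = 0 := fun k l hk => by
      unfold coordAt
      split_ifs
      · exact if_neg (by simp; omega)
      · rfl
    rw [hzj _ (by omega), h1 i j hi, h1 j i hj]
    simp
  refine finrank_extSpace_eq_one (by omega) c z
    (toCochain_mem_cocycles (by omega) c (by simp) hz hz0 hwt)
    (toCochain_notMem_coboundaries (j := 1) (m := ⟨0, by omega⟩) c le_rfl (by omega)
      (by simp [z]) (by simp [wCoef])) hz0 hwt ?_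
  rintro x ⟨hx, hbr⟩
  refine ⟨x 1 ⟨0, by omega⟩, fun j hj hjp m hm => ?_⟩
  have hstep : ∀ j : ℕ, 2 ≤ j → j + 2 ≤ p →
      coordAt (x (j + 1)) (p - j) = j * coordAt (x j) (p + 1 - j) := fun j hj hjp => by
    have h := hbr 1 j le_rfl (by omega) (by omega) hjp ⟨p - j, by omega⟩
    have hj1 : ((j - 1 : ℕ) : K) ≠ 0 := natCast_ne_zero_of_lt (p := p) (by omega) (by omega)
    rw [Nat.cast_sub (by omega), Nat.cast_one] at hj1
    simp only [coordAt_of_le (x 1) (show p ≤ p - j + j by omega), mul_zero, sub_zero,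
      wCoef_one_left, show p - j + 1 = p + 1 - j by omega, Nat.cast_one, add_comm 1 j] at h
    rw [Nat.cast_sub (by omega), Nat.cast_add, CharP.cast_eq_zero K p, Nat.cast_one] at h
    rw [coordAt, dif_pos (by omega)]
    refine mul_left_cancel₀ hj1 (h.trans ?_)
    ring
  have hzero : ∀ d j : ℕ, 2 ≤ j → j + 1 + d = p → coordAt (x j) (p + 1 - j) = 0 := by
    intro d
    induction d with
    | zero => intro j _ h; rw [hx j (by omega), coordAt_zero]
    | succ d ih =>
      intro j hj h
      have h1 := ih (j + 1) (by omega) (by omega)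
      rw [show p + 1 - (j + 1) = p - j by omega, hstep j hj (by omega)] at h1
      exact (mul_eq_zero.1 h1).resolve_left (natCast_ne_zero_of_lt (p := p) (by omega) (by omega))
  have hdvd : p ∣ m + j - 1 := by
    rw [← CharP.cast_eq_zero_iff K p, Nat.cast_sub (by omega)]
    push_cast
    linear_combination -hm
  rcases Nat.eq_zero_or_pos ((m : ℕ) + j - 1) with h0 | h0
  · obtain rfl : j = 1 := by omega
    have hm0 : m = ⟨0, by omega⟩ := Fin.ext (by simpa using h0)
    simp [z, hm0]
  · have hmj : (m : ℕ) + j - 1 = p := Nat.eq_of_dvd_of_lt_two_mul h0.ne' hdvd (by omega)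
    have h := hzero (p - 1 - j) j (by omega) (by omega)
    rw [show p + 1 - j = m by omega, coordAt_val] at h
    rw [h, hzj j (by omega)]
    simp

lemma finrank_extSpace_neg_one_zero [CharP K p] (hp : 3 < p) (c : K) :
    Module.finrank K (extSpace K p 0 (vermaRho K p c (-1)) (oneDimRho K 0)) = 1 := by
  let z : ℕ → Fin p → K := fun j m =>
    if 1 ≤ j ∧ j + 2 ≤ p ∧ (m : ℕ) + j + 1 = p then ((j + 1).factorial : K) else 0
  have hz0 : z 0 = 0 := by ext m; simp [z]
  have hwt : ∀ (j : ℕ) (m : Fin p), (-1 : K) - (m : ℕ) - 0 ≠ j → z j m = 0 := by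
    intro j m h
    refine if_neg fun ⟨_, _, h'⟩ => h ?_
    have : ((m + j + 1 : ℕ) : K) = 0 := by
      rw [h', CharP.cast_eq_zero]
    push_cast at this
    linear_combination -this
  have hz : PosCocycle (-1 : K) z := by
    refine ⟨fun j hj => ?_, fun i j hi hj hip hjp m => ?_⟩
    · ext m
      exact if_neg (by omega)
    · have key : ∀ i j : ℕ, 1 ≤ j → j + 2 ≤ p →
          wCoef K (-1) i (m + i) * coordAt (z j) (m + i) =
            if (m : ℕ) + i + j + 1 = p then ((i + j).factorial : K) * (j * (j + 1)) else 0 := by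
        intro i j hj hjp
        split_ifs with h
        · rw [coordAt, dif_pos (by omega), show z j _ = _ from if_pos ⟨hj, hjp, h⟩,
            Nat.factorial_succ]
          push_cast
          linear_combination ((j : K) + 1) * factorial_mul_wCoef_neg_one (K := K) h i
        · unfold coordAt
          split_ifs
          · rw [show z j _ = _ from if_neg fun h' => h h'.2.2, mul_zero]
          · rw [mul_zero]
      rw [key i j hj hjp, key j i hi hip, add_right_comm (m : ℕ) j i, add_comm j i]
      split_ifs with h
      · by_cases hij : i + j + 2 ≤ p
        · rw [show z (i + j) m = _ from if_pos ⟨by omega, hij, by omega⟩, Nat.factorial_succ]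
          push_cast
          ring
        · rw [show z (i + j) m = _ from if_neg fun h' => hij h'.2.1]
          have : ((i + j + 1 : ℕ) : K) = 0 := by
            rw [show i + j + 1 = p by omega, CharP.cast_eq_zero]
          push_cast at this
          linear_combination (((i + j).factorial : K) * (i - j)) * this
      · rw [show z (i + j) m = _ from if_neg fun h' => h (by omega), mul_zero, sub_zero]
  have h2 : (2 : K) ≠ 0 := by
    exact_mod_cast natCast_ne_zero_of_lt (K := K) (p := p) (n := 2) (by omega) (by omega)
  refine finrank_extSpace_eq_one (by omega) c z
    (toCochain_mem_cocycles (by omega) c (by simp) hz hz0 hwt)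
    (toCochain_notMem_coboundaries (j := 1) (m := ⟨p - 2, by omega⟩) c le_rfl (by omega)
      ?_ ?_) hz0 hwt ?_
  · rw [show z 1 _ = _ from if_pos ⟨le_rfl, by omega, by simp; omega⟩]
    simpa using h2
  · have : ((p - 2 + 1 : ℕ) : K) = -1 := by
      rw [show p - 2 + 1 = p - 1 by omega, Nat.cast_sub (by omega), CharP.cast_eq_zero]
      simp
    simp only [wCoef_one_left, this]
    ring
  rintro x ⟨hx, hbr⟩
  obtain ⟨b, hb⟩ : ∃ b : K, b * 2 = coordAt (x 2) (p - 1 - 2) - 2 * coordAt (x 1) (p - 1 - 1) :=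
    ⟨_, div_mul_cancel₀ _ h2⟩
  obtain ⟨a, ha⟩ : ∃ a : K, a + b = coordAt (x 1) (p - 1 - 1) := ⟨_, sub_add_cancel _ _⟩
  have hrec : ∀ j : ℕ, j + 3 ≤ p → coordAt (x (j + 2)) (p - 1 - (j + 2)) =
      (j + 1).factorial * (a * (j + 2) + b * (j + 2) ^ 2) := by
    intro j
    induction j with
    | zero =>
      intro _
      simp
      linear_combination -hb - 2 * ha
    | succ j ih =>
      intro hj
      have h := hbr 1 (j + 2) le_rfl (by omega) (by omega) (by omega) ⟨p - 1 - (j + 3), by omega⟩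
      have hj1 : ((j + 1 : ℕ) : K) ≠ 0 := natCast_ne_zero_of_lt (p := p) (by omega) (by omega)
      have f1 := factorial_mul_wCoef_neg_one (K := K) (p := p) (n := p - 1 - 1) (j := 1) (by omega)
        (j + 2)
      simp only [show p - 1 - (j + 3) + 1 = p - 1 - (j + 2) by omega,
        show p - 1 - (j + 3) + (j + 2) = p - 1 - 1 by omega, ih (by omega), ← ha,
        wCoef_one_left, add_comm 1 (j + 2)] at h
      rw [Nat.cast_sub (by omega), Nat.cast_sub (by omega), CharP.cast_eq_zero K p] at h
      rw [coordAt, dif_pos (by omega)]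
      refine mul_left_cancel₀ hj1 ?_
      simp only [Nat.factorial_succ] at h f1 ⊢
      push_cast at h f1 ⊢
      simp only [show j + 1 + 2 = j + 2 + 1 by omega] at h ⊢
      linear_combination h - (a + b) * f1
  have hab : a = b := by
    have h := hrec (p - 3) (by omega)
    rw [hx _ (by omega), coordAt_zero] at h
    have hc : ((p - 3 : ℕ) : K) = -3 := by
      rw [Nat.cast_sub (by omega), CharP.cast_eq_zero]; simp
    have hf : ((p - 3 + 1).factorial : K) ≠ 0 := by
      rw [Ne, CharP.cast_eq_zero_iff K p,
        ((CharP.char_is_prime_or_zero K p).resolve_right (by omega)).dvd_factorial]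
      omega
    rw [hc] at h
    have := (mul_eq_zero.1 h.symm).resolve_left hf
    linear_combination -this
  subst hab
  refine ⟨a, fun j hj hjp m hm => ?_⟩
  have hdvd : p ∣ m + j + 1 := by
    rw [← CharP.cast_eq_zero_iff K p]
    push_cast
    linear_combination -hm
  have hmj : (m : ℕ) + j + 1 = p := Nat.eq_of_dvd_of_lt_two_mul (by omega) hdvd (by omega)
  rw [show z j m = _ from if_pos ⟨hj, hjp, hmj⟩, ← coordAt_val (x j), show (m : ℕ) = p - 1 - j by omega]
  rcases Nat.lt_or_ge j 2 with h1 | h1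
  · obtain rfl : j = 1 := by omega
    rw [← ha]
    simp
    ring
  · obtain ⟨j, rfl⟩ := Nat.exists_eq_add_of_le' h1
    rw [hrec j (by omega), Nat.factorial_succ (j + 2), Nat.factorial_succ (j + 1)]
    push_cast
    ring

end Auxiliary

/-- If `χ` has height `-1` or `0` and `(λ, λ') = (0, p-1)` or `(p-1, 0)`, then, over
`W_0`, `Ext(K_{λ'}, V_χ(λ)) ≅ K`. -/
theorem ext_Klambda'_verma_zero_pm1
    (K : Type) [Field K] [IsAlgClosed K] (p : ℕ) [CharP K p] (hp : 3 < p)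
    (chi : ℤ → K) (hsupp : ∀ k : ℤ, (k < -1 ∨ (p : ℤ) - 2 < k) → chi k = 0)
    (hheight : ∀ k : ℤ, 0 ≤ k → chi k = 0)
    (lam lam' : K) (hlam : lam ^ p = lam) (hlam' : lam' ^ p = lam')
    (h : (lam = 0 ∧ lam' = (p : K) - 1) ∨ (lam = (p : K) - 1 ∧ lam' = 0)) :
    Module.finrank K (extSpace K p 0
        (vermaRho K p (chi (-1) ^ p) lam) (oneDimRho K lam')) = 1 := by
  rw [CharP.cast_eq_zero, zero_sub] at h
  rcases h with ⟨rfl, rfl⟩ | ⟨rfl, rfl⟩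
  · exact finrank_extSpace_zero_neg_one hp _
  · exact finrank_extSpace_neg_one_zero hp _
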